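/- Fix x₀ ∈ ℝ. Let ω and α be N×N complex matrix-valued kernels such that α satisfies the fundamental integral equation α(x₀,y) + ω(x₀,y) + ∫_{x₀}^{∞} α(x₀,z)·ω(z,y) dz = 0 for all y > x₀. Let r be a kernel on (x₀,∞)×(x₀,∞) satisfying the resolvent equation r(z,y) + ω(z,y) + ∫_{x₀}^{∞} r(z,s)·ω(s,y) ds = 0 for all z, y > x₀. Let f and g be N×N complex matrix-valued functions on [x₀,∞), and set the perturbed kernel ω̃(z,y) := ω(z,y) + f(z)·g(y). Define g̃(y) := g(y) + ∫_{x₀}^{∞} g(z)·r(z,y) dz, n := f(x₀) + ∫_{x₀}^{∞} α(x₀,z)·f(z) dz, and Γ := I + ∫_{x₀}^{∞} g̃(z)·f(z) dz, and assume the matrix Γ is invertible. Then the kernel α̃(y) := α(x₀,y) − n·Γ⁻¹·g̃(y) satisfies the perturbed fundamental integral equation α̃(y) + ω̃(x₀,y) + ∫_{x₀}^{∞} α̃(z)·ω̃(z,y) dz = 0 for all y > x₀. -/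

import Mathlib

open MeasureTheory Set Matrix

/-- Entrywise integral of a matrix-valued function over a set of reals. -/
noncomputable def mInt {N : ℕ} (s : Set ℝ) (F : ℝ → Matrix (Fin N) (Fin N) ℂ) :
    Matrix (Fin N) (Fin N) ℂ :=
  Matrix.of fun i j => ∫ t in s, F t i j

def MI {N : ℕ} (s : Set ℝ) (F : ℝ → Matrix (Fin N) (Fin N) ℂ) : Prop :=
  ∀ i j, IntegrableOn (fun t => F t i j) s

theorem MI.add {N : ℕ} {s : Set ℝ} {F G : ℝ → Matrix (Fin N) (Fin N) ℂ}
    (hF : MI s F) (hG : MI s G) : MI s (fun t => F t + G t) :=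
  fun i j => (hF i j).add (hG i j)

theorem MI.sub {N : ℕ} {s : Set ℝ} {F G : ℝ → Matrix (Fin N) (Fin N) ℂ}
    (hF : MI s F) (hG : MI s G) : MI s (fun t => F t - G t) :=
  fun i j => (hF i j).sub (hG i j)

theorem MI.neg {N : ℕ} {s : Set ℝ} {F : ℝ → Matrix (Fin N) (Fin N) ℂ}
    (hF : MI s F) : MI s (fun t => - F t) :=
  fun i j => (hF i j).neg

theorem MI.cmul {N : ℕ} {s : Set ℝ} {F : ℝ → Matrix (Fin N) (Fin N) ℂ}
    (hF : MI s F) (C : Matrix (Fin N) (Fin N) ℂ) : MI s (fun t => C * F t) := by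
  intro i j
  simp only [Matrix.mul_apply]
  exact integrable_finsetSum _ fun k _ => (hF k j).const_mul _

theorem MI.mulc {N : ℕ} {s : Set ℝ} {F : ℝ → Matrix (Fin N) (Fin N) ℂ}
    (hF : MI s F) (C : Matrix (Fin N) (Fin N) ℂ) : MI s (fun t => F t * C) := by
  intro i j
  simp only [Matrix.mul_apply]
  exact integrable_finsetSum _ fun k _ => (hF i k).mul_const _

theorem mInt_add {N : ℕ} {s : Set ℝ} {F G : ℝ → Matrix (Fin N) (Fin N) ℂ}
    (hF : MI s F) (hG : MI s G) :
    mInt s (fun t => F t + G t) = mInt s F + mInt s G := by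
  ext i j
  exact integral_add (hF i j) (hG i j)

theorem mInt_sub {N : ℕ} {s : Set ℝ} {F G : ℝ → Matrix (Fin N) (Fin N) ℂ}
    (hF : MI s F) (hG : MI s G) :
    mInt s (fun t => F t - G t) = mInt s F - mInt s G := by
  ext i j
  exact integral_sub (hF i j) (hG i j)

theorem mInt_neg {N : ℕ} {s : Set ℝ} (F : ℝ → Matrix (Fin N) (Fin N) ℂ) :
    mInt s (fun t => - F t) = - mInt s F := by
  ext i j
  exact integral_neg _

theorem mInt_cmul {N : ℕ} {s : Set ℝ} {F : ℝ → Matrix (Fin N) (Fin N) ℂ}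
    (hF : MI s F) (C : Matrix (Fin N) (Fin N) ℂ) :
    mInt s (fun t => C * F t) = C * mInt s F := by
  ext i j
  simp only [mInt, Matrix.mul_apply, Matrix.of_apply]
  rw [integral_finsetSum _ fun k _ => (hF k j).const_mul _]
  exact Finset.sum_congr rfl fun k _ => integral_const_mul _ _

theorem mInt_mulc {N : ℕ} {s : Set ℝ} {F : ℝ → Matrix (Fin N) (Fin N) ℂ}
    (hF : MI s F) (C : Matrix (Fin N) (Fin N) ℂ) :
    mInt s (fun t => F t * C) = mInt s F * C := by
  ext i j
  simp only [mInt, Matrix.mul_apply, Matrix.of_apply]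
  rw [integral_finsetSum _ fun k _ => (hF i k).mul_const _]
  exact Finset.sum_congr rfl fun k _ => integral_mul_const _ _

theorem mInt_congr {N : ℕ} {s : Set ℝ} (hs : MeasurableSet s)
    {F G : ℝ → Matrix (Fin N) (Fin N) ℂ}
    (h : ∀ t ∈ s, F t = G t) : mInt s F = mInt s G := by
  ext i j
  exact setIntegral_congr_fun hs fun t ht => by simp only [h t ht]

theorem MI.congr {N : ℕ} {s : Set ℝ} (hs : MeasurableSet s)
    {F G : ℝ → Matrix (Fin N) (Fin N) ℂ}
    (hF : MI s F) (h : ∀ t ∈ s, F t = G t) : MI s G := fun i j =>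
  (hF i j).congr_fun (fun t ht => by simp only [h t ht]) hs

theorem mInt_swap {N : ℕ} {s : Set ℝ} {F : ℝ → ℝ → Matrix (Fin N) (Fin N) ℂ}
    (h : ∀ i j, IntegrableOn (fun p : ℝ × ℝ => F p.1 p.2 i j) (s ×ˢ s)) :
    MI s (fun t => mInt s (fun z => F z t)) ∧
    mInt s (fun t => mInt s (fun z => F z t)) = mInt s (fun z => mInt s (fun t => F z t)) := by
  have h2 : ∀ i j, Integrable (fun p : ℝ × ℝ => F p.1 p.2 i j)
      ((volume.restrict s).prod (volume.restrict s)) := by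
    intro i j
    rw [Measure.prod_restrict]
    exact h i j
  refine ⟨fun i j => (h2 i j).integral_prod_right, ?_⟩
  ext i j
  exact (integral_integral_swap (f := fun z t => F z t i j) (h2 i j)).symm

/-- on `(x₀,∞)`, the kernel `α̃ = α(x₀,·) − n Γ⁻¹ g̃` solves the perturbed
fundamental integral equation with the rank-one perturbed kernel `ω̃ = ω + f·g`. -/
theorem perturbed_fundamental_equation_on_Ioi
    (N : ℕ) (hN : 0 < N) (x₀ : ℝ)
    (ω α r : ℝ → ℝ → Matrix (Fin N) (Fin N) ℂ)
    (f g : ℝ → Matrix (Fin N) (Fin N) ℂ)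
    (gt : ℝ → Matrix (Fin N) (Fin N) ℂ) (n Γ : Matrix (Fin N) (Fin N) ℂ)
    -- absolute convergence of the integral in the fundamental equation
    (hfund_int : ∀ y, x₀ < y → ∀ i j,
      IntegrableOn (fun z => (α x₀ z * ω z y) i j) (Ioi x₀))
    -- the fundamental integral equation at x₀
    (hfund : ∀ y, x₀ < y →
      α x₀ y + ω x₀ y + mInt (Ioi x₀) (fun z => α x₀ z * ω z y) = 0)
    -- absolute convergence of the integral in the resolvent equation
    (hres_int : ∀ z y, x₀ < z → x₀ < y → ∀ i j,
      IntegrableOn (fun s => (r z s * ω s y) i j) (Ioi x₀))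
    -- the resolvent equation
    (hres : ∀ z y, x₀ < z → x₀ < y →
      r z y + ω z y + mInt (Ioi x₀) (fun s => r z s * ω s y) = 0)
    -- definition of g̃
    (hgt_int : ∀ y, x₀ < y → ∀ i j,
      IntegrableOn (fun z => (g z * r z y) i j) (Ioi x₀))
    (hgt : ∀ y, x₀ < y → gt y = g y + mInt (Ioi x₀) (fun z => g z * r z y))
    -- definition of n
    (hn_int : ∀ i j, IntegrableOn (fun z => (α x₀ z * f z) i j) (Ioi x₀))
    (hn : n = f x₀ + mInt (Ioi x₀) (fun z => α x₀ z * f z))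
    -- definition of Γ, assumed invertible
    (hΓ_int : ∀ i j, IntegrableOn (fun z => (gt z * f z) i j) (Ioi x₀))
    (hΓ : Γ = 1 + mInt (Ioi x₀) (fun z => gt z * f z))
    (hΓinv : IsUnit Γ)
    -- absolute convergence of the remaining integrals appearing
    (hgω_int : ∀ y, x₀ < y → ∀ i j,
      IntegrableOn (fun z => (g z * ω z y) i j) (Ioi x₀))
    (hconc_int : ∀ y, x₀ < y → ∀ i j,
      IntegrableOn (fun z =>
        ((α x₀ z - n * Γ⁻¹ * gt z) * (ω z y + f z * g y)) i j) (Ioi x₀))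
    -- absolute convergence of the iterated integrals (so orders may be interchanged)
    (hFub : ∀ y, x₀ < y → ∀ i j,
      IntegrableOn (fun p : ℝ × ℝ => (g p.1 * r p.1 p.2 * ω p.2 y) i j)
        ((Ioi x₀) ×ˢ (Ioi x₀))) :
    -- conclusion: the perturbed fundamental integral equation
    ∀ y, x₀ < y →
      (α x₀ y - n * Γ⁻¹ * gt y) + (ω x₀ y + f x₀ * g y)
        + mInt (Ioi x₀) (fun z => (α x₀ z - n * Γ⁻¹ * gt z) * (ω z y + f z * g y)) = 0 := by
  intro y hy
  have hs : MeasurableSet (Ioi x₀) := measurableSet_Ioi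
  obtain ⟨hK, hsw⟩ := mInt_swap (F := fun z s => g z * r z s * ω s y) (hFub y hy)
  -- integrand of gt * ω
  have e1 : ∀ t ∈ Ioi x₀, g t * ω t y + mInt (Ioi x₀) (fun z => g z * r z t * ω t y)
      = gt t * ω t y := by
    intro t ht
    rw [hgt t ht, mInt_mulc (hgt_int t ht), add_mul]
  have hgtω : MI (Ioi x₀) (fun t => gt t * ω t y) :=
    (MI.add (hgω_int y hy) hK).congr hs e1
  have e2 : ∀ z ∈ Ioi x₀, mInt (Ioi x₀) (fun t => g z * r z t * ω t y)
      = -(g z * r z y) - g z * ω z y := by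
    intro z hz
    have h1 : mInt (Ioi x₀) (fun s => r z s * ω s y) = -r z y - ω z y := by
      rw [eq_neg_of_add_eq_zero_right (hres z y hz hy)]; abel
    simp only [mul_assoc]
    rw [mInt_cmul (hres_int z y hz hy), h1, mul_sub, mul_neg]
  have key : mInt (Ioi x₀) (fun t => gt t * ω t y) = g y - gt y := by
    rw [← mInt_congr hs e1, mInt_add (hgω_int y hy) hK, hsw, mInt_congr hs e2,
      mInt_sub (MI.neg (hgt_int y hy)) (hgω_int y hy), mInt_neg, hgt y hy]
    abel
  have hG : Γ⁻¹ * Γ = 1 :=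
    Matrix.nonsing_inv_mul _ ((Matrix.isUnit_iff_isUnit_det _).1 hΓinv)
  set M := n * Γ⁻¹ with hM
  have hMΓ : M * Γ = n := by rw [hM, mul_assoc, hG, mul_one]
  have e3 : ∀ z ∈ Ioi x₀, (α x₀ z - M * gt z) * (ω z y + f z * g y)
      = (α x₀ z * ω z y + α x₀ z * f z * g y)
        - (M * (gt z * ω z y) + M * (gt z * f z * g y)) := by
    intro z _
    noncomm_ring
  have i1 : MI (Ioi x₀) (fun z => α x₀ z * ω z y) := hfund_int y hy
  have i2 : MI (Ioi x₀) (fun z => α x₀ z * f z * g y) := MI.mulc hn_int _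
  have i3 : MI (Ioi x₀) (fun z => gt z * f z * g y) := MI.mulc hΓ_int _
  have h1 : mInt (Ioi x₀) (fun z => α x₀ z * ω z y) = -α x₀ y - ω x₀ y := by
    rw [eq_neg_of_add_eq_zero_right (hfund y hy)]; abel
  have h2 : mInt (Ioi x₀) (fun z => α x₀ z * f z) = n - f x₀ := by rw [hn]; abel
  have h3 : mInt (Ioi x₀) (fun z => gt z * f z) = Γ - 1 := by rw [hΓ]; abel
  rw [mInt_congr hs e3, mInt_sub (i1.add i2) ((hgtω.cmul M).add (i3.cmul M)),
    mInt_add i1 i2, mInt_add (hgtω.cmul M) (i3.cmul M), mInt_cmul hgtω, mInt_cmul i3,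
    mInt_mulc hn_int, mInt_mulc hΓ_int, key, h1, h2, h3]
  have h4 : M * ((Γ - 1) * g y) = n * g y - M * g y := by
    rw [← mul_assoc, mul_sub, hMΓ, mul_one, sub_mul]
  rw [h4, sub_mul, mul_sub]
  abel
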